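/- Let V be an n×(p·d) random real matrix uniformly distributed on the Stiefel manifold V(n, p·d), with columns partitioned into p consecutive blocks of d columns, and let A, B ⊆ {1,…,p} be disjoint block-index sets with |A| + |B| = s. Let C > 0 and λ̃ > 0. Suppose (p − s)·d ≥ n, √(s d/n) ≤ λ̃/(120 C √s), √(s/p) ≤ min(λ̃/(120 C √s), 1/20), λ̃/(60 C √s) < 1, and λ̃/(120 C √s) ≤ 1/20. Then P[ ‖(p d/n)·V_Aᵀ V_B‖ ≥ λ̃/(7 C √s) ] ≤ 5·exp(−n λ̃²/(28800 C² s)). -/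

import Mathlib

open MeasureTheory ProbabilityTheory Filter Matrix
open scoped ENNReal NNReal

noncomputable section

/-- Euclidean norm of a finite real vector. -/
def euclNorm {ι : Type*} [Fintype ι] (v : ι → ℝ) : ℝ := Real.sqrt (∑ i, v i ^ 2)

/-- Spectral norm (largest singular value) of a real matrix. -/
def specNorm {m n : Type*} [Fintype m] [Fintype n] [DecidableEq n] (A : Matrix m n ℝ) : ℝ :=
  ‖LinearMap.toContinuousLinearMap (Matrix.toEuclideanLin A)‖

instance {m n α : Type*} [MeasurableSpace α] : MeasurableSpace (Matrix m n α) :=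
  inferInstanceAs (MeasurableSpace (m → n → α))

/-- `V` is uniformly distributed on the Stiefel manifold `V(n, ι)`:
`V Vᵀ = I_n` almost surely and `V·O` has the same distribution as `V` for every
fixed orthogonal matrix `O`. -/
def IsUniformStiefel {Ω ι : Type*} [MeasurableSpace Ω] [Fintype ι] [DecidableEq ι]
    (P : Measure Ω) {n : ℕ} (V : Ω → Matrix (Fin n) ι ℝ) : Prop :=
  Measurable V ∧ (∀ᵐ ω ∂P, V ω * (V ω)ᵀ = 1) ∧
    ∀ O : Matrix ι ι ℝ, O * Oᵀ = 1 →
      Measure.map (fun ω => V ω * O) P = Measure.map V P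

/-- The submatrix of a block matrix `V` consisting of the column blocks indexed by `J`. -/
def blockCols {n p d : ℕ} (V : Matrix (Fin n) (Fin p × Fin d) ℝ) (J : Finset (Fin p)) :
    Matrix (Fin n) ({j // j ∈ J} × Fin d) ℝ :=
  fun i jk => V i (jk.1.1, jk.2)

/-- The `k`-th column block of a block matrix `V`. -/
def colBlock {n p d : ℕ} (V : Matrix (Fin n) (Fin p × Fin d) ℝ) (k : Fin p) :
    Matrix (Fin n) (Fin d) ℝ :=
  fun i l => V i (k, l)


lemma aux_gauss_int_coord {ι : Type*} [Fintype ι] (c : ι → ℝ) (hc : ∀ i, 0 < c i) :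
    ∫⁻ x : EuclideanSpace ℝ ι, ENNReal.ofReal (Real.exp (-∑ i, c i * (x i) ^ 2))
      = ENNReal.ofReal (∏ i, √(Real.pi / c i)) := by
  have h1 := (PiLp.volume_preserving_ofLp ι).lintegral_comp_emb
    (MeasurableEquiv.toLp 2 (ι → ℝ)).symm.measurableEmbedding
    (fun y : ι → ℝ => ENNReal.ofReal (Real.exp (-∑ i, c i * (y i) ^ 2)))
  rw [h1]
  have h2 : ∀ y : ι → ℝ, Real.exp (-∑ i, c i * (y i) ^ 2)
      = ∏ i, Real.exp (-(c i) * (y i) ^ 2) := by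
    intro y
    rw [← Real.exp_sum, ← Finset.sum_neg_distrib]
    simp
  have h3 : Integrable (fun y : ι → ℝ => ∏ i, Real.exp (-(c i) * (y i) ^ 2)) :=
    Integrable.fintype_prod (μ := fun _ => volume)
      (f := fun i (t : ℝ) => Real.exp (-(c i) * t ^ 2))
      (fun i => integrable_exp_neg_mul_sq (hc i))
  simp_rw [h2]
  rw [← ofReal_integral_eq_lintegral_ofReal h3
    (Eventually.of_forall fun y => Finset.prod_nonneg fun i _ => (Real.exp_pos _).le)]
  congr 1
  rw [integral_fintype_prod_volume_eq_prod (fun i (t : ℝ) => Real.exp (-(c i) * t ^ 2))]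
  exact Finset.prod_congr rfl fun i _ => integral_gaussian _

lemma aux_gauss_int {ι : Type*} [Fintype ι] [DecidableEq ι] {n : ℕ} (W : Matrix (Fin n) ι ℝ)
    (hW : W * Wᵀ = 1) (hn : n ≤ Fintype.card ι) (α β : ℝ) (hβ : 0 < β) (hαβ : 0 < α + β) :
    ∫⁻ g : EuclideanSpace ℝ ι, ENNReal.ofReal (Real.exp
        (-(α * ((W *ᵥ g.ofLp) ⬝ᵥ (W *ᵥ g.ofLp)) + β * (g.ofLp ⬝ᵥ g.ofLp))))
      = ENNReal.ofReal (√(Real.pi / (α + β)) ^ n * √(Real.pi / β) ^ (Fintype.card ι - n)) := by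
  obtain ⟨f⟩ : Nonempty (Fin n ↪ ι) := by
    apply Function.Embedding.nonempty_of_card_le; simpa using hn
  let w : Fin n → EuclideanSpace ℝ ι := fun i => WithLp.toLp 2 (W i)
  have hw : Orthonormal ℝ w := by
    rw [orthonormal_iff_ite]
    intro i j
    have : (W * Wᵀ) j i = (1 : Matrix (Fin n) (Fin n) ℝ) j i := by rw [hW]
    rw [Matrix.mul_apply, Matrix.one_apply] at this
    simp only [w, EuclideanSpace.inner_toLp_toLp, dotProduct]
    simpa [eq_comm] using this
  let v : ι → EuclideanSpace ℝ ι := Function.extend f w 0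
  have hv : Orthonormal ℝ ((Set.range f).domRestrict v) := by
    let e := Equiv.ofInjective f f.injective
    have h := hw.comp e.symm e.symm.injective
    convert h using 1
    funext x
    obtain ⟨_, i, rfl⟩ := x
    have : e.symm ⟨f i, i, rfl⟩ = i := by
      rw [Equiv.symm_apply_eq]; rfl
    simp [v, this, f.injective.extend_apply, Set.domRestrict]
  obtain ⟨b, hb⟩ := hv.exists_orthonormalBasis_extension_of_card_eq (by simp)
  have hb' : ∀ i, b (f i) = w i := fun i => by
    rw [hb _ ⟨i, rfl⟩]; simp [v, f.injective.extend_apply]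
  let c : ι → ℝ := fun j => β + if j ∈ Set.range f then α else 0
  have hc : ∀ j, 0 < c j := by
    intro j; simp only [c]; split_ifs <;> linarith
  have key : ∀ g : EuclideanSpace ℝ ι,
      α * ((W *ᵥ g.ofLp) ⬝ᵥ (W *ᵥ g.ofLp)) + β * (g.ofLp ⬝ᵥ g.ofLp)
        = ∑ j, c j * (b.repr g j) ^ 2 := by
    intro g
    have e1 : g.ofLp ⬝ᵥ g.ofLp = ∑ j, (b.repr g j) ^ 2 := by
      rw [← EuclideanSpace.real_norm_sq_eq, LinearIsometryEquiv.norm_map,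
        EuclideanSpace.real_norm_sq_eq]
      simp [dotProduct, sq]
    have e2 : ∀ i, (W *ᵥ g.ofLp) i = b.repr g (f i) := by
      intro i
      rw [b.repr_apply_apply, hb']
      simp only [w, EuclideanSpace.inner_eq_star_dotProduct]
      simp [Matrix.mulVec, dotProduct_comm]
    have e3 : (W *ᵥ g.ofLp) ⬝ᵥ (W *ᵥ g.ofLp)
        = ∑ j, (if j ∈ Set.range f then (1:ℝ) else 0) * (b.repr g j) ^ 2 := by
      simp only [dotProduct, e2, ite_mul, one_mul, zero_mul]
      rw [← Finset.sum_filter]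
      have : Finset.univ.filter (fun j => j ∈ Set.range f) = Finset.univ.map f := by
        ext j; simp
      rw [this, Finset.sum_map]
      simp [sq]
    rw [e1, e3, Finset.mul_sum, Finset.mul_sum, ← Finset.sum_add_distrib]
    refine Finset.sum_congr rfl fun j _ => ?_
    simp only [c]
    split_ifs <;> ring
  simp_rw [key]
  rw [b.measurePreserving_repr.lintegral_comp_emb
    (b.repr.toMeasurableEquiv.measurableEmbedding)
    (fun x : EuclideanSpace ℝ ι => ENNReal.ofReal (Real.exp (-∑ i, c i * (x i) ^ 2))),
    aux_gauss_int_coord c hc]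
  congr 1
  have h4 : ∀ j, √(Real.pi / c j) = if j ∈ Finset.univ.map f then √(Real.pi / (α + β))
      else √(Real.pi / β) := by
    intro j
    simp only [c, Finset.mem_map, Finset.mem_univ, true_and, Set.mem_range]
    split_ifs <;> simp [add_comm]
  simp_rw [h4]
  rw [Finset.prod_ite]
  simp only [Finset.prod_const]
  congr 2
  · simp [Finset.card_image_of_injective _ f.injective]
  · rw [Finset.filter_not, Finset.card_sdiff]
    simp [Finset.card_image_of_injective _ f.injective]

/-- Householder reflection. -/
lemma aux_householder {ι : Type*} [Fintype ι] [DecidableEq ι] (x y : ι → ℝ)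
    (h : x ⬝ᵥ x = y ⬝ᵥ y) :
    ∃ O : Matrix ι ι ℝ, O * Oᵀ = 1 ∧ O *ᵥ x = y := by
  by_cases hz : x = y
  · exact ⟨1, by simp, by simp [hz]⟩
  let z := x - y
  have hzz : z ⬝ᵥ z ≠ 0 := by
    rw [Ne, dotProduct_self_eq_zero]
    exact sub_ne_zero.mpr hz
  let k : ℝ := 2 / (z ⬝ᵥ z)
  have hk : k * (z ⬝ᵥ z) = 2 := by simp only [k]; field_simp
  refine ⟨1 - k • Matrix.vecMulVec z z, ?_, ?_⟩
  · have ht : (1 - k • Matrix.vecMulVec z z)ᵀ = 1 - k • Matrix.vecMulVec z z := by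
      rw [Matrix.transpose_sub, Matrix.transpose_smul, Matrix.transpose_vecMulVec]; simp
    rw [ht, sub_mul, mul_sub, mul_sub, one_mul, mul_one, one_mul, Matrix.smul_mul,
      Matrix.mul_smul, Matrix.vecMulVec_mul_vecMulVec]
    ext i j
    simp [Matrix.vecMulVec_apply]
    linear_combination (k * z i * z j) * hk
  · have h2 : 2 * (z ⬝ᵥ x) = z ⬝ᵥ z := by
      simp only [z, sub_dotProduct, dotProduct_sub]
      rw [dotProduct_comm y x]; linarith
    have h3 : k * (z ⬝ᵥ x) = 1 := by linarith [congrArg (fun t => k * t) h2]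
    ext i
    rw [Matrix.sub_mulVec, Matrix.smul_mulVec, Matrix.vecMulVec_mulVec]
    simp
    have : k * (z ⬝ᵥ x) * z i = z i := by rw [h3, one_mul]
    simp only [z, Pi.sub_apply] at this ⊢
    linarith

lemma aux_measurable_quad {ι : Type*} [Fintype ι] {n : ℕ} :
    Measurable fun z : Matrix (Fin n) ι ℝ × EuclideanSpace ℝ ι =>
      (z.1 *ᵥ z.2.ofLp) ⬝ᵥ (z.1 *ᵥ z.2.ofLp) := by
  have hent : ∀ (i : Fin n) (j : ι), Measurable fun z : Matrix (Fin n) ι ℝ × EuclideanSpace ℝ ι =>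
      z.1 i j := fun i j =>
    ((measurable_pi_apply j).comp (measurable_pi_apply (X := fun _ : Fin n => ι → ℝ) i)).comp
      measurable_fst
  have hvec : ∀ (j : ι), Measurable fun z : Matrix (Fin n) ι ℝ × EuclideanSpace ℝ ι =>
      z.2.ofLp j := fun j => by fun_prop
  have hmv : ∀ (i : Fin n), Measurable fun z : Matrix (Fin n) ι ℝ × EuclideanSpace ℝ ι =>
      (z.1 *ᵥ z.2.ofLp) i := fun i => by
    simp only [Matrix.mulVec, dotProduct]
    exact Finset.measurable_sum _ fun j _ => (hent i j).mul (hvec j)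
  simp only [dotProduct]
  exact Finset.measurable_sum _ fun i _ => (hmv i).mul (hmv i)

lemma aux_measurable_quad_left {ι : Type*} [Fintype ι] {n : ℕ} (g : EuclideanSpace ℝ ι) :
    Measurable fun W : Matrix (Fin n) ι ℝ => (W *ᵥ g.ofLp) ⬝ᵥ (W *ᵥ g.ofLp) := by
  have hent : ∀ (i : Fin n) (j : ι), Measurable fun W : Matrix (Fin n) ι ℝ => W i j := fun i j =>
    (measurable_pi_apply j).comp (measurable_pi_apply (X := fun _ : Fin n => ι → ℝ) i)
  have hmv : ∀ (i : Fin n), Measurable fun W : Matrix (Fin n) ι ℝ => (W *ᵥ g.ofLp) i := fun i => by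
    simp only [Matrix.mulVec, dotProduct]
    exact Finset.measurable_sum _ fun j _ => (hent i j).mul_const _
  simp only [dotProduct]
  exact Finset.measurable_sum _ fun i _ => (hmv i).mul (hmv i)

lemma aux_measurableSet_bad {ι : Type*} [Fintype ι] {n : ℕ} (a b : ℝ) (g : EuclideanSpace ℝ ι) :
    MeasurableSet {W : Matrix (Fin n) ι ℝ |
      0 ≤ a * ((W *ᵥ g.ofLp) ⬝ᵥ (W *ᵥ g.ofLp)) + b * (g.ofLp ⬝ᵥ g.ofLp)} := by
  have h := ((aux_measurable_quad_left (n := n) g).const_mul a).add_const (b * (g.ofLp ⬝ᵥ g.ofLp))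
  exact measurableSet_le measurable_const h

lemma aux_measurable_normsq {ι : Type*} [Fintype ι] :
    Measurable fun z : EuclideanSpace ℝ ι => z.ofLp ⬝ᵥ z.ofLp := by
  simp only [dotProduct]
  fun_prop

lemma aux_measurable_mul {ι : Type*} [Fintype ι] {n : ℕ} (O : Matrix ι ι ℝ) :
    Measurable fun W : Matrix (Fin n) ι ℝ => W * O := by
  refine measurable_pi_iff.mpr fun i => measurable_pi_iff.mpr fun j => ?_
  simp only [Matrix.mul_apply]
  exact Finset.measurable_sum _ fun k _ =>
    ((measurable_pi_apply k).comp
      (measurable_pi_apply (X := fun _ : Fin n => ι → ℝ) i)).mul_const _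

lemma aux_rot {ι : Type*} [Fintype ι] [DecidableEq ι] {n : ℕ}
    (Q : Measure (Matrix (Fin n) ι ℝ))
    (hQ2 : ∀ O : Matrix ι ι ℝ, O * Oᵀ = 1 → Q.map (fun W => W * O) = Q)
    (a b : ℝ) (w g : EuclideanSpace ℝ ι) (hw : w ≠ 0) (hg : g ≠ 0) :
    Q {W | 0 ≤ a * ((W *ᵥ g.ofLp) ⬝ᵥ (W *ᵥ g.ofLp)) + b * (g.ofLp ⬝ᵥ g.ofLp)}
      = Q {W | 0 ≤ a * ((W *ᵥ w.ofLp) ⬝ᵥ (W *ᵥ w.ofLp)) + b * (w.ofLp ⬝ᵥ w.ofLp)} := by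
  have hns : ∀ v : EuclideanSpace ℝ ι, v ≠ 0 → 0 < v.ofLp ⬝ᵥ v.ofLp := by
    intro v hv
    have : v.ofLp ⬝ᵥ v.ofLp = ‖v‖ ^ 2 := by
      rw [EuclideanSpace.real_norm_sq_eq]; simp [dotProduct, sq]
    rw [this]; have := norm_pos_iff.mpr hv; positivity
  have hw' := hns w hw
  have hg' := hns g hg
  let k : ℝ := √((g.ofLp ⬝ᵥ g.ofLp) / (w.ofLp ⬝ᵥ w.ofLp))
  have hk : 0 < k := Real.sqrt_pos.mpr (div_pos hg' hw')
  have hk2 : k * k * (w.ofLp ⬝ᵥ w.ofLp) = g.ofLp ⬝ᵥ g.ofLp := by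
    simp only [k]; rw [Real.mul_self_sqrt (div_pos hg' hw').le]; field_simp
  obtain ⟨O, hO, hOx⟩ := aux_householder (k • w.ofLp) g.ofLp (by
    rw [smul_dotProduct, dotProduct_smul, smul_eq_mul, smul_eq_mul, ← mul_assoc, hk2])
  have hm : MeasurableSet
      {W : Matrix (Fin n) ι ℝ | 0 ≤ a * ((W *ᵥ w.ofLp) ⬝ᵥ (W *ᵥ w.ofLp)) + b * (w.ofLp ⬝ᵥ w.ofLp)} :=
    aux_measurableSet_bad a b _
  conv_rhs => rw [← hQ2 O hO, Measure.map_apply (aux_measurable_mul O) hm]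
  congr 1
  ext W
  have e1 : W *ᵥ g.ofLp = k • ((W * O) *ᵥ w.ofLp) := by
    rw [← hOx, Matrix.mulVec_smul, Matrix.mulVec_smul, Matrix.mulVec_mulVec]
  simp only [Set.mem_ofPred_eq, Set.preimage_ofPred_eq]
  rw [e1, ← hk2, smul_dotProduct, dotProduct_smul, smul_eq_mul, smul_eq_mul]
  rw [show ∀ x y : ℝ, a * (k * (k * x)) + b * (k * k * y) = (k * k) * (a * x + b * y) by
    intros; ring]
  exact mul_nonneg_iff_of_pos_left (by positivity)

lemma aux_tail {ι : Type*} [Fintype ι] [DecidableEq ι] {n : ℕ}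
    (Q : Measure (Matrix (Fin n) ι ℝ)) [IsProbabilityMeasure Q]
    (hQ1 : ∀ᵐ W ∂Q, W * Wᵀ = 1)
    (hQ2 : ∀ O : Matrix ι ι ℝ, O * Oᵀ = 1 → Q.map (fun W => W * O) = Q)
    (hn : n ≤ Fintype.card ι)
    (a b : ℝ) (hb : 0 < 1 - 2 * b) (hab : 0 < 1 - 2 * a - 2 * b)
    (w : EuclideanSpace ℝ ι) (hw : w ≠ 0) :
    Q {W | 0 ≤ a * ((W *ᵥ w.ofLp) ⬝ᵥ (W *ᵥ w.ofLp)) + b * (w.ofLp ⬝ᵥ w.ofLp)}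
      ≤ ENNReal.ofReal (√(1 / (1 - 2 * a - 2 * b)) ^ n
          * √(1 / (1 - 2 * b)) ^ (Fintype.card ι - n)) := by
  set F := Q {W | 0 ≤ a * ((W *ᵥ w.ofLp) ⬝ᵥ (W *ᵥ w.ofLp)) + b * (w.ofLp ⬝ᵥ w.ofLp)} with hF
  have : Nontrivial (EuclideanSpace ℝ ι) := ⟨w, 0, hw⟩
  let G : EuclideanSpace ℝ ι → ℝ≥0∞ := fun g =>
    ENNReal.ofReal (Real.exp (-∑ i, (1 / 2 : ℝ) * (g i) ^ 2))
  have hG : ∫⁻ g, G g = ENNReal.ofReal (√(2 * Real.pi) ^ Fintype.card ι) := by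
    rw [aux_gauss_int_coord (fun _ => (1 / 2 : ℝ)) (fun _ => by norm_num)]
    congr 1
    rw [Finset.prod_const, Finset.card_univ]
    congr 2
    ring
  have hGm : Measurable G := by
    simp only [G]; fun_prop
  let H : Matrix (Fin n) ι ℝ → EuclideanSpace ℝ ι → ℝ≥0∞ := fun W g =>
    ENNReal.ofReal (Real.exp
        (-((-a) * ((W *ᵥ g.ofLp) ⬝ᵥ (W *ᵥ g.ofLp)) + (1 / 2 - b) * (g.ofLp ⬝ᵥ g.ofLp))))
  have hHm : Measurable (Function.uncurry H) := by
    refine ENNReal.measurable_ofReal.comp (Real.measurable_exp.comp (Measurable.neg ?_))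
    exact (aux_measurable_quad.const_mul _).add
      ((aux_measurable_normsq.comp measurable_snd).const_mul _)
  have step1 : F * ∫⁻ g, G g ≤ ∫⁻ g, ∫⁻ W, H W g ∂Q := by
    rw [← lintegral_const_mul _ hGm]
    refine lintegral_mono_ae ?_
    have hne : ∀ᵐ g : EuclideanSpace ℝ ι, g ≠ 0 := by
      simp [ae_iff]
    filter_upwards [hne] with g hg
    rw [hF, ← aux_rot Q hQ2 a b w g hw hg]
    have hm : MeasurableSet {W : Matrix (Fin n) ι ℝ |
        0 ≤ a * ((W *ᵥ g.ofLp) ⬝ᵥ (W *ᵥ g.ofLp)) + b * (g.ofLp ⬝ᵥ g.ofLp)} :=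
    aux_measurableSet_bad a b _
    rw [mul_comm, ← lintegral_indicator_const hm]
    refine lintegral_mono fun W => ?_
    by_cases hW : W ∈ {W : Matrix (Fin n) ι ℝ |
        0 ≤ a * ((W *ᵥ g.ofLp) ⬝ᵥ (W *ᵥ g.ofLp)) + b * (g.ofLp ⬝ᵥ g.ofLp)}
    · rw [Set.indicator_of_mem hW]
      refine ENNReal.ofReal_le_ofReal (Real.exp_le_exp.mpr ?_)
      have : ∑ i, (1 / 2 : ℝ) * (g i) ^ 2 = 1 / 2 * (g.ofLp ⬝ᵥ g.ofLp) := by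
        simp [dotProduct, Finset.mul_sum, sq]
      rw [this]
      have := Set.mem_ofPred_eq ▸ hW
      linarith
    · rw [Set.indicator_of_notMem hW]; exact zero_le
  have step2 : ∫⁻ g, ∫⁻ W, H W g ∂Q = ENNReal.ofReal
      (√(Real.pi / (-a + (1 / 2 - b))) ^ n * √(Real.pi / (1 / 2 - b)) ^ (Fintype.card ι - n)) := by
    rw [← lintegral_lintegral_swap hHm.aemeasurable]
    have : ∀ᵐ W ∂Q, ∫⁻ g, H W g = ENNReal.ofReal
      (√(Real.pi / (-a + (1 / 2 - b))) ^ n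
        * √(Real.pi / (1 / 2 - b)) ^ (Fintype.card ι - n)) := by
      filter_upwards [hQ1] with W hW
      exact aux_gauss_int W hW hn (-a) (1 / 2 - b) (by linarith) (by linarith)
    rw [lintegral_congr_ae this]
    simp
  have hpos : 0 < √(2 * Real.pi) ^ Fintype.card ι := by positivity
  rw [step2, hG] at step1
  have e : √(Real.pi / (-a + (1 / 2 - b))) ^ n * √(Real.pi / (1 / 2 - b)) ^ (Fintype.card ι - n)
      = (√(1 / (1 - 2 * a - 2 * b)) ^ n * √(1 / (1 - 2 * b)) ^ (Fintype.card ι - n))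
        * √(2 * Real.pi) ^ Fintype.card ι := by
    have r1 : ∀ x : ℝ, 0 < x → √(Real.pi / (x / 2)) = √(1 / x) * √(2 * Real.pi) := by
      intro x hx
      rw [← Real.sqrt_mul (by positivity)]
      congr 1; field_simp
    rw [show -a + (1 / 2 - b) = (1 - 2 * a - 2 * b) / 2 by ring,
      show (1 / 2 - b) = (1 - 2 * b) / 2 by ring, r1 _ hab, r1 _ hb, mul_pow, mul_pow]
    have : √(2 * Real.pi) ^ Fintype.card ι
        = √(2 * Real.pi) ^ n * √(2 * Real.pi) ^ (Fintype.card ι - n) := by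
      rw [← pow_add]; congr 1; omega
    rw [this]; ring
  rw [e, ENNReal.ofReal_mul' hpos.le] at step1
  exact (ENNReal.mul_le_mul_iff_left (ENNReal.ofReal_pos.mpr hpos).ne' ENNReal.ofReal_ne_top).mp step1

lemma aux_real_bound (n N : ℕ) (hn : 0 < n) (hnN : n ≤ N) (η : ℝ) (h1 : -(1 / 3) ≤ η)
    (h2 : η ≤ 1 / 3) :
    let t := (n : ℝ) / N * (1 + η)
    0 < 1 - 2 * (-(η / 4 * t)) ∧ 0 < 1 - 2 * (η / 4) - 2 * (-(η / 4 * t)) ∧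
    √(1 / (1 - 2 * (η / 4) - 2 * (-(η / 4 * t)))) ^ n * √(1 / (1 - 2 * (-(η / 4 * t)))) ^ (N - n)
      ≤ Real.exp (-(n * η ^ 2 / 16)) := by
  intro t
  have hnR : (0 : ℝ) < n := by exact_mod_cast hn
  have hNR : (0 : ℝ) < N := by exact_mod_cast (lt_of_lt_of_le hn hnN)
  have hnNR : (n : ℝ) ≤ N := by exact_mod_cast hnN
  have hκ : (n : ℝ) / N ≤ 1 := by rw [div_le_one hNR]; exact hnNR
  have hκ0 : 0 < (n : ℝ) / N := by positivity
  have ht0 : 0 ≤ t := mul_nonneg hκ0.le (by linarith)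
  have ht1 : t ≤ 4 / 3 := by
    calc t ≤ 1 * (1 + η) := by
          apply mul_le_mul_of_nonneg_right hκ; linarith
      _ ≤ 4 / 3 := by linarith
  have hY : 1 - 2 * (-(η / 4 * t)) = 1 + η / 2 * t := by ring
  have hX : 1 - 2 * (η / 4) - 2 * (-(η / 4 * t)) = 1 - η / 2 + η / 2 * t := by ring
  rw [hY, hX]
  have hYt : -(1 / 2) ≤ η / 2 * t := by nlinarith
  have hYpos : 0 < 1 + η / 2 * t := by linarith
  have hmu : 0 < 1 - η / 2 := by linarith
  have hXge : (1 + η / 2 * t) * (1 - η / 2) ≤ 1 - η / 2 + η / 2 * t := by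
    nlinarith [mul_nonneg (sq_nonneg η) ht0]
  have hXpos : 0 < 1 - η / 2 + η / 2 * t := lt_of_lt_of_le (mul_pos hYpos hmu) hXge
  refine ⟨hYpos, hXpos, ?_⟩
  set X := 1 - η / 2 + η / 2 * t
  set Y := 1 + η / 2 * t
  have hYN : (1 + η / 2 * (1 + η)) ^ n ≤ Y ^ N := by
    have hb := one_add_mul_self_le_rpow_one_add (s := η / 2 * t) (by linarith)
      (p := (N : ℝ) / n) (by rw [le_div_iff₀ hnR]; linarith)
    have e1 : 1 + (N : ℝ) / n * (η / 2 * t) = 1 + η / 2 * (1 + η) := by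
      simp only [t]; field_simp
    rw [e1] at hb
    calc (1 + η / 2 * (1 + η)) ^ n ≤ (Y ^ ((N : ℝ) / n)) ^ n :=
          pow_le_pow_left₀ (by nlinarith) hb n
      _ = Y ^ N := by
          rw [← Real.rpow_natCast, ← Real.rpow_mul hYpos.le, div_mul_cancel₀ _ hnR.ne',
            Real.rpow_natCast]
  have hbase : Real.exp (η ^ 2 / 8) ≤ (1 + η / 2 * (1 + η)) * (1 - η / 2) := by
    have hx : η ^ 2 ≤ 1 / 9 := by nlinarith
    have h3 : 1 + η ^ 2 / 6 ≤ (1 + η / 2 * (1 + η)) * (1 - η / 2) := by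
      nlinarith [mul_nonneg (sq_nonneg η) (sub_nonneg.mpr h2)]
    have h4 : Real.exp (η ^ 2 / 8) ≤ 1 / (1 - η ^ 2 / 8) := by
      have := Real.add_one_le_exp (-(η ^ 2 / 8))
      rw [Real.exp_neg] at this
      rw [le_div_iff₀ (by linarith)]
      have hp := Real.exp_pos (η ^ 2 / 8)
      calc Real.exp (η ^ 2 / 8) * (1 - η ^ 2 / 8)
          ≤ Real.exp (η ^ 2 / 8) * (Real.exp (η ^ 2 / 8))⁻¹ :=
            mul_le_mul_of_nonneg_left (by linarith) hp.le
        _ = 1 := mul_inv_cancel₀ hp.ne'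
    refine h4.trans (le_trans ?_ h3)
    rw [div_le_iff₀ (by linarith)]
    nlinarith [sq_nonneg η]
  have hmain : Real.exp (n * (η ^ 2 / 8)) ≤ X ^ n * Y ^ (N - n) := by
    calc Real.exp (n * (η ^ 2 / 8)) = Real.exp (η ^ 2 / 8) ^ n := by rw [Real.exp_nat_mul]
      _ ≤ ((1 + η / 2 * (1 + η)) * (1 - η / 2)) ^ n := pow_le_pow_left₀ (Real.exp_pos _).le hbase n
      _ = (1 + η / 2 * (1 + η)) ^ n * (1 - η / 2) ^ n := mul_pow _ _ _
      _ ≤ Y ^ N * (1 - η / 2) ^ n := mul_le_mul_of_nonneg_right hYN (by positivity)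
      _ = (Y * (1 - η / 2)) ^ n * Y ^ (N - n) := by
          rw [mul_pow]
          have : Y ^ N = Y ^ n * Y ^ (N - n) := by rw [← pow_add]; congr 1; omega
          rw [this]; ring
      _ ≤ X ^ n * Y ^ (N - n) := by
          refine mul_le_mul_of_nonneg_right ?_ (by positivity)
          exact pow_le_pow_left₀ (mul_pos hYpos hmu).le hXge n
  have hsq : √(1 / X) ^ n * √(1 / Y) ^ (N - n) = √(1 / (X ^ n * Y ^ (N - n))) := by
    have hX' : (0 : ℝ) ≤ 1 / X := by positivity
    have hY' : (0 : ℝ) ≤ 1 / Y := by positivity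
    symm
    rw [Real.sqrt_eq_iff_mul_self_eq (by positivity) (by positivity)]
    symm
    calc √(1 / X) ^ n * √(1 / Y) ^ (N - n) * (√(1 / X) ^ n * √(1 / Y) ^ (N - n))
        = (√(1 / X) * √(1 / X)) ^ n * (√(1 / Y) * √(1 / Y)) ^ (N - n) := by
          rw [mul_pow, mul_pow]; ring
      _ = 1 / (X ^ n * Y ^ (N - n)) := by
          rw [Real.mul_self_sqrt hX', Real.mul_self_sqrt hY', div_pow, div_pow, one_pow, one_pow,
            div_mul_div_comm, one_mul]
  rw [hsq]
  have : Real.exp (-(n * η ^ 2 / 16)) = √(1 / Real.exp (n * (η ^ 2 / 8))) := by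
    symm
    rw [Real.sqrt_eq_iff_mul_self_eq (by positivity) (by positivity), ← Real.exp_add, one_div,
      ← Real.exp_neg]
    congr 1; ring
  rw [this]
  apply Real.sqrt_le_sqrt
  exact one_div_le_one_div_of_le (Real.exp_pos _) hmain

lemma aux_tail_eta {ι : Type*} [Fintype ι] [DecidableEq ι] {n : ℕ}
    (Q : Measure (Matrix (Fin n) ι ℝ)) [IsProbabilityMeasure Q]
    (hQ1 : ∀ᵐ W ∂Q, W * Wᵀ = 1)
    (hQ2 : ∀ O : Matrix ι ι ℝ, O * Oᵀ = 1 → Q.map (fun W => W * O) = Q)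
    (hn0 : 0 < n) (hn : n ≤ Fintype.card ι)
    (η : ℝ) (h1 : -(1 / 3) ≤ η) (h2 : η ≤ 1 / 3)
    (w : EuclideanSpace ℝ ι) (hw : w ≠ 0) :
    Q {W | 0 ≤ η / 4 * ((W *ᵥ w.ofLp) ⬝ᵥ (W *ᵥ w.ofLp))
        + -(η / 4 * ((n : ℝ) / (Fintype.card ι : ℕ) * (1 + η))) * (w.ofLp ⬝ᵥ w.ofLp)}
      ≤ ENNReal.ofReal (Real.exp (-(n * η ^ 2 / 16))) := by
  obtain ⟨ha, hb, hc⟩ := aux_real_bound n (Fintype.card ι) hn0 hn η h1 h2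
  exact (aux_tail Q hQ1 hQ2 hn _ _ ha hb w hw).trans (ENNReal.ofReal_le_ofReal hc)

lemma aux_tail_J {ι J : Type*} [Fintype ι] [DecidableEq ι] [Fintype J] {n : ℕ} (e : J ↪ ι)
    (Q : Measure (Matrix (Fin n) ι ℝ)) [IsProbabilityMeasure Q]
    (hQ1 : ∀ᵐ W ∂Q, W * Wᵀ = 1)
    (hQ2 : ∀ O : Matrix ι ι ℝ, O * Oᵀ = 1 → Q.map (fun W => W * O) = Q)
    (hn0 : 0 < n) (hn : n ≤ Fintype.card ι)
    (δ : ℝ) (h1 : 0 < δ) (h2 : δ ≤ 1 / 3)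
    (u : EuclideanSpace ℝ J) (hu : u ≠ 0) :
    Q {W | δ * (u.ofLp ⬝ᵥ u.ofLp) ≤ |((Fintype.card ι : ℕ) : ℝ) / n *
        ((W.submatrix id e *ᵥ u.ofLp) ⬝ᵥ (W.submatrix id e *ᵥ u.ofLp)) - (u.ofLp ⬝ᵥ u.ofLp)|}
      ≤ ENNReal.ofReal (2 * Real.exp (-(n * δ ^ 2 / 16))) := by
  let w : EuclideanSpace ℝ ι := WithLp.toLp 2 (Function.extend e u.ofLp 0)
  have hwJ : ∀ j, w.ofLp (e j) = u.ofLp j := fun j => e.injective.extend_apply _ _ _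
  have hw0 : ∀ i, i ∉ Set.range e → w.ofLp i = 0 := fun i hi => by
    simp only [w]
    rw [Function.extend_apply' _ _ _ (by simpa using hi)]; rfl
  have hsum : ∀ f : ι → ℝ, (∑ i, f i * w.ofLp i) = ∑ j, f (e j) * u.ofLp j := by
    intro f
    simp_rw [← hwJ]
    exact (Finset.sum_of_injOn e e.injective.injOn (by simp) (fun i _ hi => by rw [hw0 i (by simpa using hi), mul_zero]) (by simp)).symm
  have hww : w.ofLp ⬝ᵥ w.ofLp = u.ofLp ⬝ᵥ u.ofLp := by
    simp only [dotProduct]; rw [hsum]; simp_rw [hwJ]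
  have hWw : ∀ W : Matrix (Fin n) ι ℝ, W *ᵥ w.ofLp = W.submatrix id e *ᵥ u.ofLp := by
    intro W; ext i
    simp only [Matrix.mulVec, dotProduct]; rw [hsum]; rfl
  have hw : w ≠ 0 := by
    intro h
    apply hu
    ext j
    rw [← hwJ, h]; rfl
  have hN : (0 : ℝ) < (Fintype.card ι : ℕ) := by exact_mod_cast (lt_of_lt_of_le hn0 hn)
  have hnR : (0 : ℝ) < n := by exact_mod_cast hn0
  have hp := aux_tail_eta Q hQ1 hQ2 hn0 hn δ (by linarith) h2 w hw
  have hm := aux_tail_eta Q hQ1 hQ2 hn0 hn (-δ) (by linarith) (by linarith) w hw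
  rw [two_mul, ENNReal.ofReal_add (Real.exp_pos _).le (Real.exp_pos _).le]
  rw [neg_sq] at hm
  refine le_trans (le_trans (measure_mono ?_) (measure_union_le _ _)) (add_le_add hp hm)
  intro W hW
  simp only [Set.mem_ofPred_eq, Set.mem_union] at hW ⊢
  rw [← hWw, ← hww] at hW
  set x := (W *ᵥ w.ofLp) ⬝ᵥ (W *ᵥ w.ofLp)
  set y := w.ofLp ⬝ᵥ w.ofLp
  set N : ℝ := ((Fintype.card ι : ℕ) : ℝ)
  have hκ : 0 < (n : ℝ) / N := by positivity
  have hx : x = (n : ℝ) / N * (N / n * x) := by field_simp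
  rcases le_abs.mp hW with h | h
  · left
    have : 0 ≤ δ / 4 * ((n : ℝ) / N) * (N / n * x - y - δ * y) :=
      mul_nonneg (by positivity) (by linarith)
    calc (0 : ℝ) ≤ _ := this
      _ = δ / 4 * ((n : ℝ) / N * (N / n * x)) + -(δ / 4 * ((n : ℝ) / N * (1 + δ))) * y := by ring
      _ = _ := by rw [← hx]
  · right
    have : 0 ≤ δ / 4 * ((n : ℝ) / N) * (-(N / n * x - y) - δ * y) :=
      mul_nonneg (by positivity) (by linarith)
    calc (0 : ℝ) ≤ _ := this
      _ = -δ / 4 * ((n : ℝ) / N * (N / n * x)) + -(-δ / 4 * ((n : ℝ) / N * (1 + -δ))) * y := by ring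
      _ = _ := by rw [← hx]

lemma aux_measurable_quad_sub {ι J : Type*} [Fintype J] {n : ℕ} (e : J ↪ ι) :
    Measurable fun z : Matrix (Fin n) ι ℝ × EuclideanSpace ℝ J =>
      (z.1.submatrix id e *ᵥ z.2.ofLp) ⬝ᵥ (z.1.submatrix id e *ᵥ z.2.ofLp) := by
  have hent : ∀ (i : Fin n) (j : J), Measurable fun z : Matrix (Fin n) ι ℝ × EuclideanSpace ℝ J =>
      z.1 i (e j) := fun i j =>
    ((measurable_pi_apply (e j)).comp (measurable_pi_apply (X := fun _ : Fin n => ι → ℝ) i)).comp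
      measurable_fst
  have hvec : ∀ (j : J), Measurable fun z : Matrix (Fin n) ι ℝ × EuclideanSpace ℝ J =>
      z.2.ofLp j := fun j => by fun_prop
  have hmv : ∀ (i : Fin n), Measurable fun z : Matrix (Fin n) ι ℝ × EuclideanSpace ℝ J =>
      (z.1.submatrix id e *ᵥ z.2.ofLp) i := fun i => by
    simp only [Matrix.mulVec, dotProduct]
    exact Finset.measurable_sum _ fun j _ => (hent i j).mul (hvec j)
  simp only [dotProduct]
  exact Finset.measurable_sum _ fun i _ => (hmv i).mul (hmv i)

lemma aux_average {ι J : Type*} [Fintype ι] [DecidableEq ι] [Fintype J] {n : ℕ} (e : J ↪ ι)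
    (Q : Measure (Matrix (Fin n) ι ℝ)) [IsProbabilityMeasure Q]
    (hQ1 : ∀ᵐ W ∂Q, W * Wᵀ = 1)
    (hQ2 : ∀ O : Matrix ι ι ℝ, O * Oᵀ = 1 → Q.map (fun W => W * O) = Q)
    (hn0 : 0 < n) (hn : n ≤ Fintype.card ι)
    (δ : ℝ) (h1 : 0 < δ) (h2 : δ ≤ 1 / 3) :
    ∃ S : Set (Matrix (Fin n) ι ℝ), MeasurableSet S ∧
      (∀ W, (∃ u₀ : EuclideanSpace ℝ J, ‖u₀‖ = 1 ∧ ∀ u ∈ Metric.ball u₀ (1 / 5),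
        δ * (u.ofLp ⬝ᵥ u.ofLp) ≤ |((Fintype.card ι : ℕ) : ℝ) / n *
        ((W.submatrix id e *ᵥ u.ofLp) ⬝ᵥ (W.submatrix id e *ᵥ u.ofLp)) - (u.ofLp ⬝ᵥ u.ofLp)|)
        → W ∈ S) ∧
      Q S ≤ ENNReal.ofReal (6 ^ Fintype.card J * (2 * Real.exp (-(n * δ ^ 2 / 16)))) := by
  let Bad : Set (Matrix (Fin n) ι ℝ × EuclideanSpace ℝ J) := {z | (z.2 ∈ Metric.ball 0 (6 / 5)
    ∧ z.2 ≠ 0) ∧ δ * (z.2.ofLp ⬝ᵥ z.2.ofLp) ≤ |((Fintype.card ι : ℕ) : ℝ) / n *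
        ((z.1.submatrix id e *ᵥ z.2.ofLp) ⬝ᵥ (z.1.submatrix id e *ᵥ z.2.ofLp))
          - (z.2.ofLp ⬝ᵥ z.2.ofLp)|}
  have hq := aux_measurable_quad_sub (n := n) e
  have hns : Measurable fun z : Matrix (Fin n) ι ℝ × EuclideanSpace ℝ J =>
      z.2.ofLp ⬝ᵥ z.2.ofLp := aux_measurable_normsq.comp measurable_snd
  have hBad : MeasurableSet Bad := by
    refine MeasurableSet.inter (MeasurableSet.inter ?_ ?_) ?_
    · exact measurable_snd measurableSet_ball
    · exact measurable_snd (measurableSet_singleton (0 : EuclideanSpace ℝ J)).compl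
    · have ha : Measurable fun z : Matrix (Fin n) ι ℝ × EuclideanSpace ℝ J =>
          |((Fintype.card ι : ℕ) : ℝ) / n *
          ((z.1.submatrix id e *ᵥ z.2.ofLp) ⬝ᵥ (z.1.submatrix id e *ᵥ z.2.ofLp))
          - (z.2.ofLp ⬝ᵥ z.2.ofLp)| := by
        have := ((hq.const_mul (((Fintype.card ι : ℕ) : ℝ) / n)).sub hns).norm
        simpa [Real.norm_eq_abs] using this
      exact measurableSet_le (hns.const_mul δ) ha
  let h : Matrix (Fin n) ι ℝ → ℝ≥0∞ := fun W => volume (Prod.mk W ⁻¹' Bad)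
  have hh : Measurable h := measurable_measure_prodMk_left hBad
  set v₁ := volume (Metric.ball (0 : EuclideanSpace ℝ J) (1 / 5)) with hv₁
  have hv₁0 : v₁ ≠ 0 := (Metric.measure_ball_pos _ _ (by norm_num)).ne'
  have hv₁t : v₁ ≠ ⊤ := measure_ball_lt_top.ne
  have hv₂ : volume (Metric.ball (0 : EuclideanSpace ℝ J) (6 / 5))
      = ENNReal.ofReal (6 ^ Fintype.card J) * v₁ := by
    have := Measure.addHaar_ball_mul_of_pos (volume : Measure (EuclideanSpace ℝ J)) 0
      (show (0 : ℝ) < 6 by norm_num) (1 / 5)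
    rw [show (6 : ℝ) * (1 / 5) = 6 / 5 by norm_num] at this
    rw [this, finrank_euclideanSpace]
  set β := ENNReal.ofReal (2 * Real.exp (-(n * δ ^ 2 / 16))) with hβ
  have hint : ∫⁻ W, h W ∂Q ≤ ENNReal.ofReal (6 ^ Fintype.card J) * v₁ * β := by
    calc ∫⁻ W, h W ∂Q = (Q.prod volume) Bad := (Measure.prod_apply hBad).symm
      _ = ∫⁻ u, Q ((fun W => (W, u)) ⁻¹' Bad) := Measure.prod_apply_symm hBad
      _ ≤ ∫⁻ u, (Metric.ball (0 : EuclideanSpace ℝ J) (6 / 5)).indicator (fun _ => β) u := by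
          refine lintegral_mono fun u => ?_
          by_cases hu : u ∈ Metric.ball (0 : EuclideanSpace ℝ J) (6 / 5) ∧ u ≠ 0
          · rw [Set.indicator_of_mem hu.1]
            refine (measure_mono ?_).trans (aux_tail_J e Q hQ1 hQ2 hn0 hn δ h1 h2 u hu.2)
            intro W hW
            exact hW.2
          · have : (fun W : Matrix (Fin n) ι ℝ => (W, u)) ⁻¹' Bad = ∅ := by
              ext W
              simp only [Set.mem_preimage, Set.mem_empty_iff_false, iff_false]
              exact fun hW => hu hW.1
            simp [this]
      _ = _ := by
          rw [lintegral_indicator_const measurableSet_ball, hv₂, mul_comm]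
  refine ⟨{W | v₁ ≤ h W}, measurableSet_le measurable_const hh, ?_, ?_⟩
  · rintro W ⟨u₀, hu₀, hW⟩
    change v₁ ≤ volume _
    have : v₁ = volume (Metric.ball u₀ (1 / 5)) := by
      rw [hv₁, Measure.addHaar_ball_center volume u₀]
    rw [this]
    refine measure_mono fun u hu => ?_
    have hd : ‖u - u₀‖ < 1 / 5 := by rwa [mem_ball_iff_norm] at hu
    refine ⟨⟨?_, ?_⟩, hW u hu⟩
    · change u ∈ Metric.ball 0 (6 / 5)
      rw [mem_ball_zero_iff]
      calc ‖u‖ = ‖(u - u₀) + u₀‖ := by rw [sub_add_cancel]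
        _ ≤ ‖u - u₀‖ + ‖u₀‖ := norm_add_le _ _
        _ < 6 / 5 := by linarith
    · rintro (rfl : u = 0)
      rw [zero_sub, norm_neg, hu₀] at hd
      norm_num at hd
  · have hmk := mul_meas_ge_le_lintegral (μ := Q) hh v₁
    have := hmk.trans hint
    rw [ENNReal.ofReal_mul (by positivity), ← hβ]
    rw [mul_right_comm, mul_comm v₁] at this
    exact (ENNReal.mul_le_mul_iff_left hv₁0 hv₁t).mp this

lemma aux_ns {κ : Type*} [Fintype κ] (u : EuclideanSpace ℝ κ) : u.ofLp ⬝ᵥ u.ofLp = ‖u‖ ^ 2 := by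
  rw [EuclideanSpace.real_norm_sq_eq]; simp [dotProduct, sq]

lemma aux_det {n : ℕ} {a b : Type*} [Fintype a] [Fintype b] [DecidableEq b]
    (R : Matrix (Fin n) (a ⊕ b) ℝ) (c τ : ℝ) (hτ : 0 < τ)
    (h : τ ≤ specNorm (c • ((R.submatrix id Sum.inl)ᵀ * R.submatrix id Sum.inr))) :
    ∃ u₀ : EuclideanSpace ℝ (a ⊕ b), ‖u₀‖ = 1 ∧ ∀ u ∈ Metric.ball u₀ (1 / 5),
        7 / 18 * τ * (u.ofLp ⬝ᵥ u.ofLp) ≤ |c * ((R *ᵥ u.ofLp) ⬝ᵥ (R *ᵥ u.ofLp))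
          - (u.ofLp ⬝ᵥ u.ofLp)| := by
  let B : EuclideanSpace ℝ (a ⊕ b) → EuclideanSpace ℝ (a ⊕ b) → ℝ := fun u v => c * ((R *ᵥ u.ofLp) ⬝ᵥ (R *ᵥ v.ofLp)) - (u.ofLp ⬝ᵥ v.ofLp)
  have Badd_l : ∀ u u' v, B (u + u') v = B u v + B u' v := fun u u' v => by
    simp [B, Matrix.mulVec_add, add_dotProduct]; ring
  have Bsymm : ∀ u v, B u v = B v u := fun u v => by
    simp only [B]; rw [dotProduct_comm, dotProduct_comm u.ofLp]
  have Bsmul_l : ∀ (k : ℝ) u v, B (k • u) v = k * B u v := fun k u v => by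
    simp [B, Matrix.mulVec_smul]; ring
  have Badd_r : ∀ u v v', B u (v + v') = B u v + B u v' := fun u v v' => by
    rw [Bsymm, Badd_l, Bsymm v, Bsymm v']
  have Bsmul_r : ∀ (k : ℝ) u v, B u (k • v) = k * B u v := fun k u v => by
    rw [Bsymm, Bsmul_l, Bsymm]
  have Bsub_l : ∀ u u' v, B (u - u') v = B u v - B u' v := fun u u' v => by
    rw [sub_eq_add_neg, Badd_l, ← neg_one_smul ℝ u', Bsmul_l]; ring
  have Bsub_r : ∀ u v v', B u (v - v') = B u v - B u v' := fun u v v' => by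
    rw [Bsymm, Bsub_l, Bsymm v, Bsymm v']
  have hcont : Continuous fun u : EuclideanSpace ℝ (a ⊕ b) => |B u u| := by
    simp only [B, dotProduct, Matrix.mulVec]
    fun_prop
  by_cases hne : (Metric.sphere (0 : EuclideanSpace ℝ (a ⊕ b)) 1).Nonempty
  swap
  · -- trivial space
    exfalso
    have hb : IsEmpty b := by
      by_contra hb
      rw [not_isEmpty_iff] at hb
      obtain ⟨j⟩ := hb
      classical
      exact hne ⟨EuclideanSpace.single (Sum.inr j) 1, by simp⟩
    have : specNorm (c • ((R.submatrix id Sum.inl)ᵀ * R.submatrix id Sum.inr)) = 0 := by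
      unfold specNorm
      rw [norm_eq_zero]
      ext x
      rw [Subsingleton.elim x 0]
      simp
    linarith
  obtain ⟨u₀, hu₀, hmax⟩ := (isCompact_sphere (0 : EuclideanSpace ℝ (a ⊕ b)) 1).exists_isMaxOn hne hcont.continuousOn
  have hu₀' : ‖u₀‖ = 1 := by simpa using hu₀
  set m := |B u₀ u₀| with hm
  have hquad : ∀ u : EuclideanSpace ℝ (a ⊕ b), |B u u| ≤ m * ‖u‖ ^ 2 := by
    intro u
    by_cases hu : u = 0
    · subst hu; simp [B]
    · have hup := norm_pos_iff.mpr hu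
      have h1 : |B (‖u‖⁻¹ • u) (‖u‖⁻¹ • u)| ≤ m := hmax (by
        simp [norm_smul, hup.ne'])
      rw [Bsmul_l, Bsmul_r, ← mul_assoc, abs_mul, abs_of_pos (by positivity)] at h1
      have : |B u u| = (‖u‖⁻¹ * ‖u‖⁻¹ * |B u u|) * ‖u‖ ^ 2 := by field_simp
      rw [this]
      exact mul_le_mul_of_nonneg_right h1 (by positivity)
  have hpol1 : ∀ u v : EuclideanSpace ℝ (a ⊕ b), |B u v| ≤ m * (‖u‖ ^ 2 + ‖v‖ ^ 2) / 2 := by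
    intro u v
    have e1 : 4 * B u v = B (u + v) (u + v) - B (u - v) (u - v) := by
      simp only [Badd_l, Badd_r, Bsub_l, Bsub_r]; rw [Bsymm v u]; ring
    have h1 := hquad (u + v)
    have h2 := hquad (u - v)
    have h3 := parallelogram_law_with_norm ℝ u v
    have h4 : ‖u + v‖ ^ 2 + ‖u - v‖ ^ 2 = 2 * (‖u‖ ^ 2 + ‖v‖ ^ 2) := by nlinarith
    have h5 : m * ‖u + v‖ ^ 2 + m * ‖u - v‖ ^ 2 = m * (2 * (‖u‖ ^ 2 + ‖v‖ ^ 2)) := by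
      rw [← h4]; ring
    rw [abs_le] at h1 h2 ⊢
    constructor <;> linarith [h1.1, h1.2, h2.1, h2.2]
  have hpol : ∀ u v : EuclideanSpace ℝ (a ⊕ b), |B u v| ≤ m * (‖u‖ * ‖v‖) := by
    intro u v
    by_cases hu : u = 0
    · subst hu; simp [B]
    by_cases hv : v = 0
    · subst hv; simp [B]
    have hup := norm_pos_iff.mpr hu
    have hvp := norm_pos_iff.mpr hv
    have h1 := hpol1 (‖u‖⁻¹ • u) (‖v‖⁻¹ • v)
    rw [Bsmul_l, Bsmul_r, ← mul_assoc, abs_mul, abs_of_pos (by positivity)] at h1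
    have e1 : ‖‖u‖⁻¹ • u‖ = 1 := by simp [norm_smul, hup.ne']
    have e2 : ‖‖v‖⁻¹ • v‖ = 1 := by simp [norm_smul, hvp.ne']
    rw [e1, e2] at h1
    have : |B u v| = (‖u‖⁻¹ * ‖v‖⁻¹ * |B u v|) * (‖u‖ * ‖v‖) := by field_simp
    rw [this]
    exact mul_le_mul_of_nonneg_right (by linarith) (by positivity)
  have hm0 : 0 ≤ m := abs_nonneg _
  have hspec : specNorm (c • ((R.submatrix id Sum.inl)ᵀ * R.submatrix id Sum.inr)) ≤ m := by
    unfold specNorm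
    refine ContinuousLinearMap.opNorm_le_bound _ hm0 fun x => ?_
    set M := c • ((R.submatrix id Sum.inl)ᵀ * R.submatrix id Sum.inr) with hM
    let y : EuclideanSpace ℝ a := WithLp.toLp 2 (M *ᵥ x.ofLp)
    have hy : LinearMap.toContinuousLinearMap (Matrix.toEuclideanLin M) x = y := rfl
    rw [hy]
    let u : EuclideanSpace ℝ (a ⊕ b) := WithLp.toLp 2 (Sum.elim y.ofLp 0)
    let v : EuclideanSpace ℝ (a ⊕ b) := WithLp.toLp 2 (Sum.elim 0 x.ofLp)
    have hu : ‖u‖ = ‖y‖ := by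
      rw [← sq_eq_sq₀ (norm_nonneg _) (norm_nonneg _), ← aux_ns, ← aux_ns]
      simp [u, dotProduct]
    have hv : ‖v‖ = ‖x‖ := by
      rw [← sq_eq_sq₀ (norm_nonneg _) (norm_nonneg _), ← aux_ns, ← aux_ns]
      simp [v, dotProduct]
    have hB : B u v = ‖y‖ ^ 2 := by
      have e1 : u.ofLp ⬝ᵥ v.ofLp = 0 := by simp [u, v, dotProduct]
      have e2 : R *ᵥ u.ofLp = R.submatrix id Sum.inl *ᵥ y.ofLp := by
        ext i; simp [u, Matrix.mulVec, dotProduct]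
      have e3 : R *ᵥ v.ofLp = R.submatrix id Sum.inr *ᵥ x.ofLp := by
        ext i; simp [v, Matrix.mulVec, dotProduct]
      simp only [B]
      rw [e1, e2, e3, sub_zero, ← aux_ns]
      have e4 : y.ofLp = c • ((R.submatrix id Sum.inl)ᵀ *ᵥ (R.submatrix id Sum.inr *ᵥ x.ofLp)) := by
        simp only [y, hM]
        rw [Matrix.smul_mulVec, Matrix.mulVec_mulVec]
      calc c * ((R.submatrix id Sum.inl *ᵥ y.ofLp) ⬝ᵥ (R.submatrix id Sum.inr *ᵥ x.ofLp))
          = c * (y.ofLp ⬝ᵥ ((R.submatrix id Sum.inl)ᵀ *ᵥ (R.submatrix id Sum.inr *ᵥ x.ofLp))) := by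
            rw [Matrix.mulVec_transpose, dotProduct_comm y.ofLp, ← Matrix.dotProduct_mulVec,
              dotProduct_comm]
        _ = y.ofLp ⬝ᵥ (c • ((R.submatrix id Sum.inl)ᵀ *ᵥ (R.submatrix id Sum.inr *ᵥ x.ofLp))) := by
            rw [dotProduct_smul, smul_eq_mul]
        _ = y.ofLp ⬝ᵥ y.ofLp := by rw [← e4]
    have h1 := hpol u v
    rw [hu, hv, hB, abs_of_nonneg (by positivity)] at h1
    by_cases hy0 : ‖y‖ = 0
    · rw [hy0]; positivity
    · have hyp : 0 < ‖y‖ := lt_of_le_of_ne (norm_nonneg _) (Ne.symm hy0)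
      nlinarith
  have hmτ : τ ≤ m := h.trans hspec
  refine ⟨u₀, hu₀', fun u hu => ?_⟩
  have hd : ‖u - u₀‖ < 1 / 5 := by rwa [mem_ball_iff_norm] at hu
  have hun : ‖u‖ ≤ 6 / 5 := by
    calc ‖u‖ = ‖(u - u₀) + u₀‖ := by rw [sub_add_cancel]
        _ ≤ ‖u - u₀‖ + ‖u₀‖ := norm_add_le _ _
        _ ≤ 6 / 5 := by linarith
  have hsum : ‖u + u₀‖ ≤ 11 / 5 := (norm_add_le _ _).trans (by linarith)
  have h1 := hpol (u - u₀) (u + u₀)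
  have e1 : B (u - u₀) (u + u₀) = B u u - B u₀ u₀ := by
    simp only [Badd_r, Bsub_l]; rw [Bsymm u₀ u]; ring
  have h2 : ‖u - u₀‖ * ‖u + u₀‖ ≤ 1 / 5 * (11 / 5) :=
    mul_le_mul hd.le hsum (norm_nonneg _) (by norm_num)
  have h3 : |B u u - B u₀ u₀| ≤ m * (1 / 5 * (11 / 5)) := by
    rw [← e1]; exact h1.trans (mul_le_mul_of_nonneg_left h2 hm0)
  have h4 : m - |B u u| ≤ |B u u - B u₀ u₀| := by
    rw [abs_sub_comm (B u u) (B u₀ u₀)]; exact abs_sub_abs_le_abs_sub _ _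
  have h5 : 14 / 25 * m ≤ |B u u| := by linarith
  have h6 : ‖u‖ ^ 2 ≤ 36 / 25 := by nlinarith [norm_nonneg u]
  change _ ≤ |B u u|
  rw [aux_ns]
  calc 7 / 18 * τ * ‖u‖ ^ 2 ≤ 7 / 18 * τ * (36 / 25) :=
        mul_le_mul_of_nonneg_left h6 (by positivity)
    _ ≤ 14 / 25 * m := by linarith
    _ ≤ _ := h5

/-- **Lemma S.2, specialized.** With `t₁ = λ̃/(60C√s) − √(sd/n)`, `t₂ = λ̃/(60C√s) − √(s/p)`,
`t₃ = 1/10 − √(s/p)`, the cross-Gram bound yields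
`P[‖(pd/n)·V_Aᵀ V_B‖ ≥ λ̃/(7C√s)] ≤ 5 exp(−n λ̃²/(28800 C² s))`. -/
theorem stiefel_cross_gram_concentration_specialized
    {Ω : Type*} [MeasurableSpace Ω] (P : Measure Ω) [IsProbabilityMeasure P]
    (n p d s : ℕ) (V : Ω → Matrix (Fin n) (Fin p × Fin d) ℝ)
    (hV : IsUniformStiefel P V)
    (A B : Finset (Fin p)) (hAB : Disjoint A B) (hs : A.card + B.card = s)
    (C lam : ℝ) (hC : 0 < C) (hlam : 0 < lam)
    (hpsd : n ≤ (p - s) * d)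
    (h₁ : Real.sqrt ((s * d : ℕ) / (n : ℝ)) ≤ lam / (120 * C * Real.sqrt s))
    (h₂ : Real.sqrt ((s : ℝ) / p) ≤ min (lam / (120 * C * Real.sqrt s)) (1 / 20))
    (h₃ : lam / (60 * C * Real.sqrt s) < 1)
    (h₄ : lam / (120 * C * Real.sqrt s) ≤ 1 / 20) :
    P {ω | lam / (7 * C * Real.sqrt s)
          ≤ specNorm (((p * d : ℕ) / (n : ℝ)) • ((blockCols (V ω) A)ᵀ * blockCols (V ω) B))}
      ≤ ENNReal.ofReal (5 * Real.exp (-(n : ℝ) * lam ^ 2 / (28800 * C ^ 2 * s))) := by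
  obtain ⟨hVm, hV1, hV2⟩ := hV
  rcases Nat.eq_zero_or_pos s with hs0 | hs0
  · subst hs0
    refine prob_le_one.trans ?_
    rw [← ENNReal.ofReal_one]
    apply ENNReal.ofReal_le_ofReal
    simp
  have hspos : (0 : ℝ) < Real.sqrt s := Real.sqrt_pos.mpr (by exact_mod_cast hs0)
  have hτ : 0 < lam / (7 * C * Real.sqrt s) := by positivity
  rcases Nat.eq_zero_or_pos n with hn0 | hn0
  · subst hn0
    have hemp : {ω | lam / (7 * C * Real.sqrt s)
          ≤ specNorm (((p * d : ℕ) / ((0 : ℕ) : ℝ)) • ((blockCols (V ω) A)ᵀ * blockCols (V ω) B))}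
          = ∅ := by
      ext ω
      simp only [Set.mem_setOf_eq, Set.mem_empty_iff_false, iff_false, not_le]
      simpa [specNorm] using hτ
    rw [hemp]
    simp
  have hnR : (0 : ℝ) < n := by exact_mod_cast hn0
  let e : (({j // j ∈ A} × Fin d) ⊕ ({j // j ∈ B} × Fin d)) ↪ Fin p × Fin d :=
    ⟨Sum.elim (fun jk => (jk.1.1, jk.2)) (fun jk => (jk.1.1, jk.2)), by
      rintro (⟨⟨j, hj⟩, k⟩ | ⟨⟨j, hj⟩, k⟩) (⟨⟨j', hj'⟩, k'⟩ | ⟨⟨j', hj'⟩, k'⟩) h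
      · simp_all
      · simp only [Sum.elim_inl, Sum.elim_inr, Prod.mk.injEq] at h
        exact absurd (h.1 ▸ hj') (Finset.disjoint_left.mp hAB hj)
      · simp only [Sum.elim_inl, Sum.elim_inr, Prod.mk.injEq] at h
        exact absurd hj (Finset.disjoint_left.mp hAB (h.1 ▸ hj'))
      · simp_all⟩
  have hQp : IsProbabilityMeasure (Measure.map V P) :=
    Measure.isProbabilityMeasure_map hVm.aemeasurable
  have hmeas : MeasurableSet {W : Matrix (Fin n) (Fin p × Fin d) ℝ | W * Wᵀ = 1} := by
    have hE : {W : Matrix (Fin n) (Fin p × Fin d) ℝ | W * Wᵀ = 1}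
        = ⋂ i, ⋂ j, {W | (W * Wᵀ) i j = (1 : Matrix (Fin n) (Fin n) ℝ) i j} := by
      ext W
      simp only [Set.mem_setOf_eq, Set.mem_iInter]
      exact ⟨fun h i j => by rw [h], fun h => Matrix.ext h⟩
    rw [hE]
    refine MeasurableSet.iInter fun i => MeasurableSet.iInter fun j => ?_
    refine measurableSet_eq_fun ?_ measurable_const
    simp only [Matrix.mul_apply, Matrix.transpose_apply]
    have hent : ∀ (i : Fin n) (j : Fin p × Fin d),
        Measurable fun W : Matrix (Fin n) (Fin p × Fin d) ℝ => W i j := fun i j =>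
      (measurable_pi_apply j).comp
        (measurable_pi_apply (X := fun _ : Fin n => Fin p × Fin d → ℝ) i)
    exact Finset.measurable_sum _ fun k _ => (hent i k).mul (hent j k)
  have hQ1 : ∀ᵐ W ∂(Measure.map V P), W * Wᵀ = 1 :=
    (ae_map_iff hVm.aemeasurable hmeas).mpr hV1
  have hQ2 : ∀ O : Matrix (Fin p × Fin d) (Fin p × Fin d) ℝ, O * Oᵀ = 1 →
      (Measure.map V P).map (fun W => W * O) = Measure.map V P := fun O hO => by
    rw [Measure.map_map (aux_measurable_mul O) hVm]
    exact hV2 O hO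
  have hcard : Fintype.card (Fin p × Fin d) = p * d := by simp
  have hn : n ≤ Fintype.card (Fin p × Fin d) := by
    rw [hcard]
    exact hpsd.trans (Nat.mul_le_mul_right _ (Nat.sub_le _ _))
  set ε : ℝ := lam / (120 * C * Real.sqrt s) with hε
  have hεpos : 0 < ε := by positivity
  have hτε : lam / (7 * C * Real.sqrt s) = 120 / 7 * ε := by
    rw [hε]; field_simp
  obtain ⟨S, hS, hSsub, hSle⟩ := aux_average e (Measure.map V P) hQ1 hQ2 hn0 hn (20 / 3 * ε)
    (by positivity) (by linarith)
  have hcJ : Fintype.card (({j // j ∈ A} × Fin d) ⊕ ({j // j ∈ B} × Fin d)) = s * d := by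
    simp only [Fintype.card_sum, Fintype.card_prod, Fintype.card_coe, Fintype.card_fin]
    rw [← hs, add_mul]
  rw [hcJ] at hSle
  have hsub : {ω | lam / (7 * C * Real.sqrt s)
          ≤ specNorm (((p * d : ℕ) / (n : ℝ)) • ((blockCols (V ω) A)ᵀ * blockCols (V ω) B))}
        ⊆ V ⁻¹' S := by
    intro ω hω
    apply hSsub
    obtain ⟨u₀, hu₀, h⟩ := aux_det ((V ω).submatrix id e) ((p * d : ℕ) / (n : ℝ))
      (lam / (7 * C * Real.sqrt s)) hτ hω
    refine ⟨u₀, hu₀, fun u hu => ?_⟩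
    have h' := h u hu
    rw [hτε] at h'
    rw [hcard]
    calc 20 / 3 * ε * (u.ofLp ⬝ᵥ u.ofLp) = 7 / 18 * (120 / 7 * ε) * (u.ofLp ⬝ᵥ u.ofLp) := by ring
      _ ≤ _ := h'
  refine (measure_mono hsub).trans ?_
  rw [← Measure.map_apply hVm hS]
  refine hSle.trans (ENNReal.ofReal_le_ofReal ?_)
  have hexp : -(n : ℝ) * lam ^ 2 / (28800 * C ^ 2 * s) = -(n * ε ^ 2 / 2) := by
    rw [hε, div_pow, mul_pow, mul_pow, Real.sq_sqrt (by positivity)]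
    have : (s : ℝ) ≠ 0 := by exact_mod_cast hs0.ne'
    field_simp
    norm_num
  rw [hexp]
  have hsd : ((s * d : ℕ) : ℝ) ≤ n * ε ^ 2 := by
    have h := (Real.sqrt_le_left hεpos.le).mp h₁
    rw [div_le_iff₀ hnR] at h
    linarith
  have h6 : (6 : ℝ) ≤ Real.exp 2 := by
    have h := Real.exp_one_gt_d9
    have h2 : Real.exp 2 = Real.exp 1 * Real.exp 1 := by rw [← Real.exp_add]; norm_num
    rw [h2]; nlinarith
  have h6p : (6 : ℝ) ^ (s * d) ≤ Real.exp (2 * (n * ε ^ 2)) := by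
    calc (6 : ℝ) ^ (s * d) ≤ Real.exp 2 ^ (s * d) := pow_le_pow_left₀ (by norm_num) h6 _
      _ = Real.exp (((s * d : ℕ) : ℝ) * 2) := (Real.exp_nat_mul 2 (s * d)).symm
      _ ≤ _ := Real.exp_le_exp.mpr (by linarith)
  have hnε : 0 ≤ n * ε ^ 2 := by positivity
  calc (6 : ℝ) ^ (s * d) * (2 * Real.exp (-(n * (20 / 3 * ε) ^ 2 / 16)))
      ≤ Real.exp (2 * (n * ε ^ 2)) * (2 * Real.exp (-(n * (20 / 3 * ε) ^ 2 / 16))) :=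
        mul_le_mul_of_nonneg_right h6p (by positivity)
    _ = 2 * Real.exp (2 * (n * ε ^ 2) + -(n * (20 / 3 * ε) ^ 2 / 16)) := by
        rw [Real.exp_add]; ring
    _ ≤ 2 * Real.exp (-(n * ε ^ 2 / 2)) := by
        have : 2 * (n * ε ^ 2) + -(n * (20 / 3 * ε) ^ 2 / 16) ≤ -(n * ε ^ 2 / 2) := by
          nlinarith
        linarith [Real.exp_le_exp.mpr this]
    _ ≤ 5 * Real.exp (-(n * ε ^ 2 / 2)) := by
        linarith [Real.exp_pos (-(n * ε ^ 2 / 2))]
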